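/- Let a and b be the automorphisms of the binary rooted tree {0,1}^* defined recursively by a(0w) = 1·b(w), a(1w) = 0w, b(0w) = 0·a(w), b(1w) = 1w, and let G = ⟨a, b⟩. Then G has no free non-abelian subgroup of rank 2: there do not exist elements g, h ∈ G generating a free group of rank 2. -/

import Mathlib

mutual
  /-- `a(0w) = 1·b(w)`, `a(1w) = 0w` (`false = 0`, `true = 1`). -/
  def aFun : List Bool → List Bool
    | [] => []
    | false :: w => true :: bFun w
    | true :: w => false :: w
  /-- `b(0w) = 0·a(w)`, `b(1w) = 1w`. -/
  def bFun : List Bool → List Bool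
    | [] => []
    | false :: w => false :: aFun w
    | true :: w => true :: w
end

mutual
  /-- The inverse of `aFun`. -/
  def aInv : List Bool → List Bool
    | [] => []
    | true :: w => false :: bInv w
    | false :: w => true :: w
  /-- The inverse of `bFun`. -/
  def bInv : List Bool → List Bool
    | [] => []
    | false :: w => false :: aInv w
    | true :: w => true :: w
end

lemma left_inv_ab : ∀ w : List Bool, aInv (aFun w) = w ∧ bInv (bFun w) = w := by
  intro w
  induction w with
  | nil => exact ⟨rfl, rfl⟩
  | cons x t ih =>
    cases x
    · exact ⟨by simp [aFun, aInv, ih.2], by simp [bFun, bInv, ih.1]⟩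
    · exact ⟨by simp [aFun, aInv], by simp [bFun, bInv]⟩

lemma right_inv_ab : ∀ w : List Bool, aFun (aInv w) = w ∧ bFun (bInv w) = w := by
  intro w
  induction w with
  | nil => exact ⟨rfl, rfl⟩
  | cons x t ih =>
    cases x
    · exact ⟨by simp [aFun, aInv], by simp [bFun, bInv, ih.1]⟩
    · exact ⟨by simp [aFun, aInv, ih.2], by simp [bFun, bInv]⟩

/-- The automorphism `a` of the binary rooted tree. -/
def aPerm : Equiv.Perm (List Bool) :=
  ⟨aFun, aInv, fun w => (left_inv_ab w).1, fun w => (right_inv_ab w).1⟩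

/-- The automorphism `b` of the binary rooted tree. -/
def bPerm : Equiv.Perm (List Bool) :=
  ⟨bFun, bInv, fun w => (left_inv_ab w).2, fun w => (right_inv_ab w).2⟩

open scoped Pointwise

namespace FreeGroup

variable {α : Type*}

lemma mk_map_true_injective :
    Function.Injective fun w : List α => FreeGroup.mk (w.map fun x => (x, true)) := by
  classical
  have hred : ∀ w : List α, IsReduced (w.map fun x => (x, true)) := fun w => by
    rw [IsReduced, List.isChain_map]
    induction w with
    | nil => exact .nil
    | cons x w ih => exact ih.cons fun _ _ _ => rfl
  intro w w' h
  have h' := reduce.sound h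
  rw [(hred w).reduce_eq, (hred w').reduce_eq] at h'
  exact List.map_injective_iff.2 (fun x y hxy => (Prod.mk.inj hxy).1) h'

lemma subsingleton_of_commute (h : ∀ x y : FreeGroup α, Commute x y) : Subsingleton α := by
  refine ⟨fun x y => ?_⟩
  have hxy : [x, y] = [y, x] := mk_map_true_injective (h (of x) (of y))
  exact (List.cons.inj hxy).1

lemma exists_forall_mem_zpowers_of_subsingleton [Subsingleton α] :
    ∃ z : FreeGroup α, ∀ x, x ∈ Subgroup.zpowers z := by
  obtain h | ⟨⟨a⟩⟩ := isEmpty_or_nonempty α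
  · exact ⟨1, fun x => by rw [Subsingleton.elim x 1]; exact one_mem _⟩
  · refine ⟨of a, fun x => ?_⟩
    have hr : Set.range (of : α → FreeGroup α) = {of a} := by
      ext y
      simp only [Set.mem_range, Set.mem_singleton_iff]
      exact ⟨fun ⟨b, hb⟩ => by rw [← hb, Subsingleton.elim b a], fun hy => ⟨a, hy.symm⟩⟩
    rw [Subgroup.zpowers_eq_closure, ← hr, closure_range_of]
    trivial

/-- Commuting elements of a free group are powers of a common element. -/
lemma exists_zpow_of_commute {x y : FreeGroup α} (h : Commute x y) :
    ∃ (z : FreeGroup α) (i j : ℤ), x = z ^ i ∧ y = z ^ j := by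
  let H := Subgroup.closure {x, y}
  let e := IsFreeGroup.toFreeGroup H
  have hcomm : ∀ u v : H, u * v = v * u := by
    have : IsMulCommutative H := Subgroup.isMulCommutative_closure (by
      rintro u (rfl | rfl) v (rfl | rfl)
      exacts [rfl, h, h.symm, rfl])
    exact fun u v => mul_comm' u v
  have : Subsingleton (IsFreeGroup.Generators H) := subsingleton_of_commute fun u v => by
    have := congrArg e (hcomm (e.symm u) (e.symm v))
    simpa [Commute, SemiconjBy] using this
  obtain ⟨z, hz⟩ := exists_forall_mem_zpowers_of_subsingleton
    (α := IsFreeGroup.Generators H)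
  have key : ∀ u : H, ∃ i : ℤ, (u : FreeGroup α) = (e.symm z : FreeGroup α) ^ i := fun u => by
    obtain ⟨i, hi⟩ := hz (e u)
    refine ⟨i, ?_⟩
    rw [← Subgroup.coe_zpow, ← map_zpow]
    simp only at hi
    rw [hi, e.symm_apply_apply]
  obtain ⟨i, hi⟩ := key ⟨x, Subgroup.subset_closure (by simp)⟩
  obtain ⟨j, hj⟩ := key ⟨y, Subgroup.subset_closure (by simp)⟩
  exact ⟨_, i, j, hi, hj⟩

end FreeGroup

namespace Basilica

/-- The symmetric generating set of the group, together with a letter for the identity. -/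
inductive Letter
  | one | a | b | aInv | bInv
  deriving DecidableEq

instance : Fintype Letter where
  elems := {.one, .a, .b, .aInv, .bInv}
  complete l := by cases l <;> decide

namespace Letter

/-- The automorphism denoted by a letter. -/
def toPerm : Letter → Equiv.Perm (List Bool)
  | one => 1
  | a => aPerm
  | b => bPerm
  | aInv => aPerm⁻¹
  | bInv => bPerm⁻¹

/-- The formal inverse of a letter. -/
def inv : Letter → Letter
  | one => one
  | a => aInv
  | b => bInv
  | aInv => a
  | bInv => b

/-- The action of a letter on the first level of the tree. -/
def out : Letter → Bool → Bool
  | a, x => !x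
  | aInv, x => !x
  | _, x => x

/-- The section of a letter at a vertex of the first level. -/
def sec : Letter → Bool → Letter
  | a, false => b
  | aInv, true => bInv
  | b, false => a
  | bInv, false => aInv
  | _, _ => one

lemma toPerm_inv (l : Letter) : l.inv.toPerm = l.toPerm⁻¹ := by
  cases l <;> simp [inv, toPerm]

lemma toPerm_nil (l : Letter) : l.toPerm [] = [] := by
  cases l <;> rfl

lemma toPerm_cons (l : Letter) (x : Bool) (w : List Bool) :
    l.toPerm (x :: w) = l.out x :: (l.sec x).toPerm w := by
  cases l <;> cases x <;> rfl

end Letter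

open Letter

/-- The generating set `{1, a, b, a⁻¹, b⁻¹}`. -/
def gens : Set (Equiv.Perm (List Bool)) := Set.range toPerm

lemma one_mem_gens : 1 ∈ gens := ⟨one, rfl⟩

lemma inv_gens : gens⁻¹ = gens := by
  ext g
  rw [Set.mem_inv]
  constructor
  · rintro ⟨l, hl⟩
    exact ⟨l.inv, by rw [toPerm_inv, hl, inv_inv]⟩
  · rintro ⟨l, rfl⟩
    exact ⟨l.inv, toPerm_inv l⟩

lemma exists_mem_gens_pow {g : Equiv.Perm (List Bool)}
    (hg : g ∈ Subgroup.closure {aPerm, bPerm}) : ∃ n : ℕ, g ∈ gens ^ n := by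
  induction hg using Subgroup.closure_induction with
  | mem x hx =>
    refine ⟨1, ?_⟩
    rw [pow_one]
    rcases hx with rfl | rfl
    exacts [⟨Letter.a, rfl⟩, ⟨Letter.b, rfl⟩]
  | one => exact ⟨0, by simp⟩
  | mul x y _ _ hx hy =>
    obtain ⟨m, hm⟩ := hx
    obtain ⟨n, hn⟩ := hy
    exact ⟨m + n, by rw [pow_add]; exact Set.mul_mem_mul hm hn⟩
  | inv x _ hx =>
    obtain ⟨n, hn⟩ := hx
    refine ⟨n, ?_⟩
    rw [← inv_gens, inv_pow, Set.inv_mem_inv]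
    exact hn

lemma apply_nil_of_mem {g : Equiv.Perm (List Bool)} {n : ℕ} (hg : g ∈ gens ^ n) : g [] = [] := by
  induction n generalizing g with
  | zero =>
    obtain rfl : g = 1 := by simpa using hg
    rfl
  | succ n ih =>
    rw [pow_succ] at hg
    obtain ⟨g, hg, _, ⟨l, rfl⟩, rfl⟩ := hg
    simp [toPerm_nil, ih hg]

/-- Every element of `A` permutes the vertices of level `k`, with sections in `B`. -/
def HasSections (k : ℕ) (A B : Set (Equiv.Perm (List Bool))) : Prop :=
  ∀ g ∈ A, ∀ v : List Bool, v.length = k →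
    ∃ v' : List Bool, v'.length = k ∧ ∃ s ∈ B, ∀ u, g (v ++ u) = v' ++ s u

namespace HasSections

variable {k l : ℕ} {A B A' B' : Set (Equiv.Perm (List Bool))}

lemma zero (A : Set (Equiv.Perm (List Bool))) : HasSections 0 A A := by
  intro g hg v hv
  obtain rfl := List.length_eq_zero_iff.1 hv
  exact ⟨[], rfl, g, hg, fun _ => rfl⟩

lemma mul (h : HasSections k A B) (h' : HasSections k A' B') :
    HasSections k (A * A') (B * B') := by
  rintro _ ⟨g, hg, g', hg', rfl⟩ v hv
  obtain ⟨v', hv', s', hs', h₁⟩ := h' g' hg' v hv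
  obtain ⟨v'', hv'', s, hs, h₂⟩ := h g hg v' hv'
  exact ⟨v'', hv'', s * s', Set.mul_mem_mul hs hs', fun u => by simp [h₁, h₂]⟩

lemma one (k : ℕ) : HasSections k 1 1 := by
  rintro _ rfl v hv
  exact ⟨v, hv, 1, rfl, fun _ => rfl⟩

lemma pow (h : HasSections k A B) (n : ℕ) : HasSections k (A ^ n) (B ^ n) := by
  induction n with
  | zero => simpa using one k
  | succ n ih => simpa only [pow_succ] using ih.mul h

lemma comp {C : Set (Equiv.Perm (List Bool))} (h : HasSections k A B) (h' : HasSections l B C) :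
    HasSections (k + l) A C := by
  intro g hg v hv
  obtain ⟨w, hw, s, hs, h₁⟩ := h g hg (v.take k) (by simp [hv])
  obtain ⟨w', hw', r, hr, h₂⟩ := h' s hs (v.drop k) (by simp [hv])
  refine ⟨w ++ w', by simp [hw, hw'], r, hr, fun u => ?_⟩
  rw [List.append_assoc, ← h₂, ← h₁, ← List.append_assoc, List.take_append_drop]

end HasSections

lemma hasSections_one_gens : HasSections 1 gens gens := by
  rintro _ ⟨l, rfl⟩ v hv
  obtain ⟨x, rfl⟩ := List.length_eq_one_iff.1 hv
  exact ⟨[l.out x], rfl, _, ⟨l.sec x, rfl⟩, toPerm_cons l x⟩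

lemma hasSections_gens (k : ℕ) : HasSections k gens gens := by
  induction k with
  | zero => exact .zero _
  | succ k ih => exact ih.comp hasSections_one_gens

/-- A word of three letters is reducible if it contains the identity letter or two adjacent
mutually inverse letters. -/
abbrev Reducible (x y z : Letter) : Prop :=
  x = one ∨ y = one ∨ z = one ∨ y = x.inv ∨ z = y.inv

lemma reducible_sections : ∀ (x y z : Letter) (i j : Bool),
    Reducible ((x.sec (y.out (z.out i))).sec ((y.sec (z.out i)).out ((z.sec i).out j)))
      ((y.sec (z.out i)).sec ((z.sec i).out j)) ((z.sec i).sec j) := by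
  decide

lemma Reducible.mul_mem {x y z : Letter} (h : Reducible x y z) :
    x.toPerm * y.toPerm * z.toPerm ∈ gens ^ 2 := by
  have hm : ∀ x y : Letter, x.toPerm * y.toPerm ∈ gens ^ 2 := fun x y => by
    rw [pow_two]
    exact Set.mul_mem_mul ⟨x, rfl⟩ ⟨y, rfl⟩
  have h1 : one.toPerm = 1 := rfl
  rcases h with rfl | rfl | rfl | rfl | rfl
  · simpa [h1] using hm y z
  · simpa [h1] using hm x z
  · simpa [h1] using hm x y
  · simpa [h1, toPerm_inv] using hm one z
  · simpa [h1, toPerm_inv] using hm x one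

/-- The group is contracting: sections of level two shorten words by a factor of `2 / 3`. -/
lemma hasSections_gens_cube : HasSections 2 (gens ^ 3) (gens ^ 2) := by
  rw [pow_succ gens 2, pow_two]
  rintro _ ⟨_, ⟨_, ⟨x, rfl⟩, _, ⟨y, rfl⟩, rfl⟩, _, ⟨z, rfl⟩, rfl⟩ v hv
  obtain ⟨i, j, rfl⟩ := List.length_eq_two.1 hv
  refine ⟨[x.out (y.out (z.out i)), (x.sec (y.out (z.out i))).out
    ((y.sec (z.out i)).out ((z.sec i).out j))], rfl, _,
    pow_two gens ▸ (reducible_sections x y z i j).mul_mem, fun u => ?_⟩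
  simp only [List.cons_append, List.nil_append, Equiv.Perm.mul_apply, toPerm_cons]

/-- A length such that sections of level `2 * t` of words of this length have length two. -/
def size : ℕ → ℕ
  | 0 => 2
  | t + 1 => size t + size t / 2

lemma hasSections_size (t : ℕ) : HasSections (2 * t) (gens ^ size t) (gens ^ 2) := by
  induction t with
  | zero => exact .zero _
  | succ t ih =>
    have h := (hasSections_gens_cube.pow (size t / 2)).mul
      ((hasSections_gens 2).pow (size t % 2))
    rw [← pow_mul, ← pow_mul, ← pow_add, ← pow_add, Nat.div_add_mod] at h
    have e : 3 * (size t / 2) + size t % 2 = size (t + 1) := by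
      rw [size]
      omega
    rw [e] at h
    rw [mul_add, add_comm]
    exact h.comp ih

lemma sq_le_size (t : ℕ) : t + 2 ≤ size t ∧ t * t ≤ 4 * size t := by
  induction t with
  | zero => simp [size]
  | succ t ih =>
    rw [size]
    have : (t + 1) * (t + 1) = t * t + 2 * t + 1 := by ring
    omega

section Faithful

variable (φ : FreeGroup Bool →* Equiv.Perm (List Bool))

/-- Elements of the free group acting trivially below the vertex `v` are trivial. -/
def FaithfulBelow (v : List Bool) : Prop :=
  ∀ x, (∀ u, φ x (v ++ u) = v ++ u) → x = 1

variable {φ}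

lemma mapsTo_of_fixes {g : Equiv.Perm (List Bool)} {n : ℕ} (hg : g ∈ gens ^ n) {v : List Bool}
    {c : Bool} (h : ∀ u, g (v ++ c :: u) = v ++ c :: u) :
    g v = v ∧ ∀ u, ∃ u', g (v ++ (!c) :: u) = v ++ (!c) :: u' := by
  obtain ⟨v', hv', s, hs, hgs⟩ := ((hasSections_gens v.length).pow n) g hg v rfl
  have e := h []
  rw [hgs] at e
  obtain rfl : v' = v := (List.append_inj e hv').1
  replace h : ∀ u, s (c :: u) = c :: u := fun u => by
    have := h u
    rw [hgs] at this
    exact List.append_cancel_left this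
  constructor
  · simpa [apply_nil_of_mem hs] using hgs []
  · intro u
    obtain ⟨w, hw, r, -, hr⟩ := ((hasSections_gens 1).pow n) s hs [!c] rfl
    obtain ⟨d, rfl⟩ := List.length_eq_one_iff.1 hw
    simp only [List.cons_append, List.nil_append] at hr
    have hd : d ≠ c := by
      rintro rfl
      have := s.injective ((hr u).trans (h (r u)).symm)
      simp at this
    rw [hgs, hr, Bool.eq_not.2 hd]
    exact ⟨_, rfl⟩

lemma FaithfulBelow.exists_child
    (hφ : ∀ x, ∃ n, φ x ∈ gens ^ n) {v : List Bool} (hv : FaithfulBelow φ v) :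
    ∃ c, FaithfulBelow φ (v ++ [c]) := by
  by_contra! hc
  have key : ∀ c, ∃ x, (∀ u, φ x (v ++ c :: u) = v ++ c :: u) ∧ x ≠ 1 := fun c => by
    have := hc c
    simp only [FaithfulBelow, List.append_assoc, List.singleton_append, not_forall] at this
    obtain ⟨x, hx, hx1⟩ := this
    exact ⟨x, hx, hx1⟩
  obtain ⟨x, hx, hx1⟩ := key false
  obtain ⟨y, hy, hy1⟩ := key true
  obtain ⟨m, hm⟩ := hφ x
  obtain ⟨n, hn⟩ := hφ y
  obtain ⟨hxv, hx'⟩ := mapsTo_of_fixes hm hx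
  obtain ⟨hyv, hy'⟩ := mapsTo_of_fixes hn hy
  have hcomm : Commute x y := by
    refine (inv_mul_eq_one.1 (hv ((y * x)⁻¹ * (x * y)) fun u => ?_)).symm
    have hu : φ x (φ y (v ++ u)) = φ y (φ x (v ++ u)) := by
      rcases u with _ | ⟨_ | _, u⟩
      · simp [hxv, hyv]
      · obtain ⟨u', hu'⟩ := hy' u
        simp only [Bool.not_true] at hu'
        rw [hx, hu', hx]
      · obtain ⟨u', hu'⟩ := hx' u
        simp only [Bool.not_false] at hu'
        rw [hy, hu', hy]
    rw [map_mul, map_inv, Equiv.Perm.mul_apply, Equiv.Perm.inv_eq_iff_eq, map_mul, map_mul]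
    exact hu
  obtain ⟨z, i, j, rfl, rfl⟩ := FreeGroup.exists_zpow_of_commute hcomm
  have hpow : (z ^ i) ^ j = 1 := by
    refine hv _ fun u => ?_
    rcases u with _ | ⟨_ | _, u⟩
    · rw [map_zpow, List.append_nil]
      exact Equiv.Perm.zpow_apply_eq_self_of_apply_eq_self hxv j
    · rw [map_zpow]
      exact Equiv.Perm.zpow_apply_eq_self_of_apply_eq_self (hx u) j
    · rw [← zpow_mul, mul_comm, zpow_mul, map_zpow]
      exact Equiv.Perm.zpow_apply_eq_self_of_apply_eq_self (hy u) i
  obtain h | rfl := IsMulTorsionFree.zpow_eq_one_iff.1 hpow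
  · exact hx1 h
  · exact hy1 (zpow_zero z)

lemma exists_faithfulBelow (hinj : Function.Injective φ) (hφ : ∀ x, ∃ n, φ x ∈ gens ^ n) (k : ℕ) :
    ∃ v : List Bool, v.length = k ∧ FaithfulBelow φ v := by
  induction k with
  | zero =>
    refine ⟨[], rfl, fun x hx => hinj ?_⟩
    rw [map_one]
    exact Equiv.ext hx
  | succ k ih =>
    obtain ⟨v, hv, h⟩ := ih
    obtain ⟨c, hc⟩ := h.exists_child hφ
    exact ⟨v ++ [c], by simp [hv], hc⟩

lemma mk_map_true_mem {n : ℕ} (h : ∀ i, φ (.of i) ∈ gens ^ n) (w : List Bool) :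
    φ (FreeGroup.mk (w.map fun x => (x, true))) ∈ gens ^ (n * w.length) := by
  induction w with
  | nil => exact (map_one φ : φ 1 = 1)
  | cons x w ih =>
    rw [List.length_cons, mul_add, mul_one, add_comm, pow_add]
    refine Set.mem_mul.2 ⟨_, h x, _, ih, ?_⟩
    rw [← map_mul]
    rfl

lemma gens_pow_mono {m n : ℕ} (h : m ≤ n) : gens ^ m ⊆ gens ^ n :=
  Set.pow_subset_pow_right one_mem_gens h

/-- The number of positive words of length `m` is bounded by the number of possible actions near
a vertex below which the free group acts faithfully. -/
lemma two_pow_le (hinj : Function.Injective φ) (hφ : ∀ x, ∃ n, φ x ∈ gens ^ n) {n m t : ℕ}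
    (h : ∀ i, φ (.of i) ∈ gens ^ n) (hm : n * m ≤ size t) :
    2 ^ m ≤ 2 ^ (2 * t) * Nat.card ↥(gens ^ 2) := by
  obtain ⟨v, hv, hvf⟩ := exists_faithfulBelow hinj hφ (2 * t)
  let f : List.Vector Bool m → FreeGroup Bool := fun w => .mk (w.toList.map fun x => (x, true))
  have hf : ∀ w, φ (f w) ∈ gens ^ size t := fun w =>
    gens_pow_mono hm (by simpa using mk_map_true_mem h w.toList)
  choose v' hv' s hs hfs using fun w => hasSections_size t _ (hf w) v hv
  have hfin : Finite ↥(gens ^ 2) := by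
    rw [pow_two]
    exact ((Set.finite_range toPerm).mul (Set.finite_range toPerm)).to_subtype
  have hF : Function.Injective
      fun w => ((⟨v' w, hv' w⟩, ⟨s w, hs w⟩) : List.Vector Bool (2 * t) × ↥(gens ^ 2)) := by
    intro w₁ w₂ hw
    have hv₁₂ : v' w₁ = v' w₂ := congrArg (fun p => p.1.toList) hw
    have hs₁₂ : s w₁ = s w₂ := congrArg (fun p => p.2.1) hw
    have h1 : (f w₂)⁻¹ * f w₁ = 1 := hvf _ fun u => by
      rw [map_mul, map_inv, Equiv.Perm.mul_apply, Equiv.Perm.inv_eq_iff_eq, hfs, hfs, hv₁₂, hs₁₂]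
    exact List.Vector.toList_injective
      (FreeGroup.mk_map_true_injective (inv_mul_eq_one.1 h1).symm)
  simpa using Nat.card_le_card_of_injective _ hF

end Faithful

end Basilica

/-- The iterated monodromy group `G = ⟨a, b⟩` of `z² − 1` has no free non-abelian
subgroup of rank 2: there are no elements `g, h ∈ G` generating a free group of
rank 2 (i.e. such that the homomorphism from the free group on two generators
sending them to `g` and `h` is injective). -/
theorem statement14 :
    ¬ ∃ g h : (Subgroup.closure {aPerm, bPerm} : Subgroup (Equiv.Perm (List Bool))),
      Function.Injective
        ⇑(FreeGroup.lift (fun i : Bool => if i then g else h) :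
          FreeGroup Bool →*
            (Subgroup.closure {aPerm, bPerm} : Subgroup (Equiv.Perm (List Bool)))) := by
  rintro ⟨g, h, hinj⟩
  let φ := (Subgroup.subtype _).comp (FreeGroup.lift fun i : Bool => if i then g else h)
  have hφ : Function.Injective φ :=
    (Subgroup.subtype_injective _).comp hinj
  have hφm : ∀ x, ∃ n, φ x ∈ Basilica.gens ^ n := fun x =>
    Basilica.exists_mem_gens_pow (SetLike.coe_mem _)
  choose n hn using hφm
  let C := n (.of true) + n (.of false) + 1
  have hC : ∀ i, φ (.of i) ∈ Basilica.gens ^ C := fun i =>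
    Basilica.gens_pow_mono (by cases i <;> grind) (hn (.of i))
  let D := Nat.card ↥(Basilica.gens ^ 2)
  let t := 4 * C * (D + 3)
  have hle := Basilica.two_pow_le (m := 2 * t + D) (t := t) hφ (fun x => ⟨n x, hn x⟩) hC (by
    have h1 := (Basilica.sq_le_size t).2
    have h2 : 0 < t := Nat.mul_pos (by omega) (by omega)
    have h3 : t * t = 4 * (C * (t * (D + 3))) := by
      nth_rw 1 [show t = 4 * C * (D + 3) from rfl]
      ring
    have h4 : 2 * t + D ≤ t * (D + 3) := by nlinarith
    have h5 := Nat.mul_le_mul_left C h4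
    omega)
  rw [pow_add] at hle
  exact absurd (Nat.le_of_mul_le_mul_left hle (by positivity)) (Nat.lt_two_pow_self).not_ge
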